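/- arXiv:2603.18236 — 3 statements merged into one kernel-verified Lean document; each statement's English description precedes it below -/
import Mathlib

section
/- Let f : ℝⁿ → ℝ be continuously differentiable and μ-strongly convex with μ > 0 (i.e., ⟨∇f(x) − ∇f(y), x − y⟩ ≥ μ‖x − y‖² for all x, y), let A ∈ ℝ^{m×n} with m < n have full row rank, and let b ∈ ℝᵐ. Then there exists a unique pair (x*, λ*) ∈ ℝⁿ × ℝᵐ satisfying the KKT conditions ∇f(x*) + Aᵀλ* = 0 and A x* = b. -/
open Matrix
open scoped RealInnerProductSpace

section StronglyMonotoneGradient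

variable {E F : Type*} [NormedAddCommGroup E] [InnerProductSpace ℝ E]
  [NormedAddCommGroup F] [InnerProductSpace ℝ F]

theorem hasDerivAt_comp_add_smul_of_differentiable [CompleteSpace E] {f : E → ℝ}
    (hf : Differentiable ℝ f) (x d : E) (t : ℝ) :
    HasDerivAt (fun s : ℝ => f (x + s • d)) ⟪gradient f (x + t • d), d⟫ t := by
  have hline : HasDerivAt (fun s : ℝ => x + s • d) d t := by
    simpa using ((hasDerivAt_id t).smul_const d).const_add x
  have hgrad := (hf (x + t • d)).hasGradientAt.hasFDerivAt
  simpa [Function.comp_def] using hgrad.comp_hasDerivAt t hline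

/-- A differentiable function with `μ`-strongly monotone gradient lies above its quadratic
lower model at every point. -/
theorem add_inner_add_sq_le_of_gradient_stronglyMonotone [CompleteSpace E] {f : E → ℝ} {μ : ℝ}
    (hf : Differentiable ℝ f)
    (hsc : ∀ x y : E, μ * ‖x - y‖ ^ 2 ≤ ⟪gradient f x - gradient f y, x - y⟫) (x y : E) :
    f x + ⟪gradient f x, y - x⟫ + μ / 2 * ‖y - x‖ ^ 2 ≤ f y := by
  set d := y - x with hd
  let φ : ℝ → ℝ := fun t => f (x + t • d) - t * ⟪gradient f x, d⟫ - t ^ 2 * (μ / 2 * ‖d‖ ^ 2)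
  have hφ (t : ℝ) : HasDerivAt φ
      (⟪gradient f (x + t • d), d⟫ - ⟪gradient f x, d⟫ - t * (μ * ‖d‖ ^ 2)) t := by
    have h := ((hasDerivAt_comp_add_smul_of_differentiable hf x d t).sub
      ((hasDerivAt_id t).mul_const ⟪gradient f x, d⟫)).sub
      ((hasDerivAt_pow 2 t).mul_const (μ / 2 * ‖d‖ ^ 2))
    refine h.congr_deriv ?_
    push_cast
    ring
  have hmono : MonotoneOn φ (Set.Ici 0) := by
    refine monotoneOn_of_deriv_nonneg (convex_Ici 0)
      (fun t _ => (hφ t).continuousAt.continuousWithinAt)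
      (fun t _ => (hφ t).differentiableAt.differentiableWithinAt) fun t ht => ?_
    rw [interior_Ici, Set.mem_Ioi] at ht
    rw [(hφ t).deriv]
    have h := hsc (x + t • d) x
    rw [add_sub_cancel_left, norm_smul, inner_smul_right, inner_sub_left, mul_pow,
      Real.norm_eq_abs, sq_abs] at h
    refine nonneg_of_mul_nonneg_right ?_ ht
    linarith
  have h := hmono (Set.self_mem_Ici) (Set.mem_Ici.2 zero_le_one) zero_le_one
  simp only [φ, zero_smul, one_smul, add_zero, hd, add_sub_cancel] at h
  linarith

/-- A differentiable function with strongly monotone gradient attains its minimum on every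
nonempty closed subset of a finite-dimensional space. -/
theorem exists_isMinOn_of_gradient_stronglyMonotone [CompleteSpace E] [FiniteDimensional ℝ E]
    {f : E → ℝ} {μ : ℝ} (hμ : 0 < μ) (hf : Differentiable ℝ f)
    (hsc : ∀ x y : E, μ * ‖x - y‖ ^ 2 ≤ ⟪gradient f x - gradient f y, x - y⟫)
    {s : Set E} (hs : IsClosed s) (hne : s.Nonempty) : ∃ x ∈ s, IsMinOn f s x := by
  have := FiniteDimensional.proper_real E
  obtain ⟨x₀, hx₀⟩ := hne
  refine hf.continuous.continuousOn.exists_isMinOn' hs hx₀ (Filter.Eventually.filter_mono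
    inf_le_left ?_)
  filter_upwards [(isCompact_closedBall x₀ (2 * ‖gradient f x₀‖ / μ)).compl_mem_cocompact]
    with x hx
  rw [Set.mem_compl_iff, Metric.mem_closedBall, not_le, dist_eq_norm, div_lt_iff₀ hμ] at hx
  have hlower := add_inner_add_sq_le_of_gradient_stronglyMonotone hf hsc x₀ x
  have hcs := neg_le_of_abs_le (abs_real_inner_le_norm (gradient f x₀) (x - x₀))
  nlinarith [norm_nonneg (x - x₀)]

theorem inner_gradient_eq_zero_of_isMinOn_fiber [CompleteSpace E] {f : E → ℝ}
    (hf : Differentiable ℝ f) (T : E →ₗ[ℝ] F) {b : F} {x : E} (hx : T x = b)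
    (hmin : IsMinOn f {y | T y = b} x) {d : E} (hd : T d = 0) : ⟪gradient f x, d⟫ = 0 := by
  have hloc : IsLocalMin (fun s : ℝ => f (x + s • d)) 0 :=
    Filter.Eventually.of_forall fun s => by
      have hs : x + s • d ∈ {y | T y = b} := by simp [hx, hd]
      simpa using hmin hs
  simpa using hloc.hasDerivAt_eq_zero (hasDerivAt_comp_add_smul_of_differentiable hf x d 0)

/-- Existence and uniqueness of the KKT pair for minimizing `f` subject to `T x = b`, where `T`
is surjective and `f` has strongly monotone gradient. -/
theorem existsUnique_gradient_add_adjoint_eq_zero [CompleteSpace E] [FiniteDimensional ℝ E]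
    [FiniteDimensional ℝ F] {f : E → ℝ} {μ : ℝ} (hμ : 0 < μ) (hf : Differentiable ℝ f)
    (hsc : ∀ x y : E, μ * ‖x - y‖ ^ 2 ≤ ⟪gradient f x - gradient f y, x - y⟫)
    (T : E →ₗ[ℝ] F) (hT : Function.Surjective T) (b : F) :
    ∃! p : E × F, gradient f p.1 + T.adjoint p.2 = 0 ∧ T p.1 = b := by
  have hclosed : IsClosed {x | T x = b} :=
    isClosed_eq T.continuous_of_finiteDimensional continuous_const
  obtain ⟨x, hx, hmin⟩ := exists_isMinOn_of_gradient_stronglyMonotone hμ hf hsc hclosed (hT b)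
  have hmem : gradient f x ∈ T.adjoint.range := by
    rw [← LinearMap.orthogonal_ker, Submodule.mem_orthogonal']
    exact fun d hd => inner_gradient_eq_zero_of_isMinOn_fiber hf T hx hmin hd
  obtain ⟨l, hl⟩ := hmem
  refine ⟨(x, -l), ⟨by simp [hl], hx⟩, ?_⟩
  rintro ⟨y, k⟩ ⟨hy, hyb⟩
  dsimp only at hy hyb
  have hxb : T x = b := hx
  have hgrad : gradient f y - gradient f x = T.adjoint (-k - l) := by
    rw [eq_neg_of_add_eq_zero_left hy, ← hl, map_sub, map_neg]
  have hyx : y = x := by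
    have h := hsc y x
    rw [hgrad, LinearMap.adjoint_inner_left, map_sub, hyb, hxb, sub_self, inner_zero_right] at h
    have hsq : ‖y - x‖ ^ 2 ≤ 0 := nonpos_of_mul_nonpos_right h hμ
    rw [← sub_eq_zero, ← norm_eq_zero]
    exact pow_eq_zero_iff two_ne_zero |>.1 (le_antisymm hsq (sq_nonneg _))
  subst hyx
  have hzero : -k - l = 0 := by
    obtain ⟨z, hz⟩ := hT (-k - l)
    rw [← inner_self_eq_zero (𝕜 := ℝ)]
    nth_rewrite 2 [← hz]
    rw [← LinearMap.adjoint_inner_left, ← hgrad, sub_self, inner_zero_left]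
  rw [sub_eq_zero] at hzero
  rw [← hzero, neg_neg]

end StronglyMonotoneGradient

theorem Matrix.toEuclideanLin_surjective_of_rank_eq {m n : ℕ} {A : Matrix (Fin m) (Fin n) ℝ}
    (hA : A.rank = m) : Function.Surjective A.toEuclideanLin := by
  rw [← LinearMap.range_eq_top]
  apply Submodule.eq_top_of_finrank_eq
  rw [toEuclideanLin, toLpLin_eq_toLin, ← rank_eq_finrank_range_toLin, hA, finrank_euclideanSpace_fin]

/-- For a continuously differentiable, `μ`-strongly convex `f : ℝⁿ → ℝ`
(`μ > 0`) and a full-row-rank matrix `A ∈ ℝ^{m×n}` with `m < n`, there is a unique pair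
`(x*, λ*)` satisfying the KKT conditions `∇f(x*) + Aᵀλ* = 0` and `A x* = b`. -/
theorem kkt_existence_uniqueness
    (n m : ℕ) (hmn : m < n)
    (f : EuclideanSpace ℝ (Fin n) → ℝ) (μ : ℝ) (hμ : 0 < μ)
    (hf : ContDiff ℝ 1 f)
    (hsc : ∀ x y : EuclideanSpace ℝ (Fin n),
      μ * ‖x - y‖ ^ 2 ≤ ⟪gradient f x - gradient f y, x - y⟫)
    (A : Matrix (Fin m) (Fin n) ℝ) (hA : A.rank = m)
    (b : EuclideanSpace ℝ (Fin m)) :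
    ∃! p : EuclideanSpace ℝ (Fin n) × EuclideanSpace ℝ (Fin m),
      gradient f p.1 + Aᵀ.toEuclideanLin p.2 = 0 ∧ A.toEuclideanLin p.1 = b := by
  have h := existsUnique_gradient_add_adjoint_eq_zero hμ (hf.differentiable one_ne_zero) hsc
    A.toEuclideanLin (Matrix.toEuclideanLin_surjective_of_rank_eq hA) b
  rwa [← Matrix.toEuclideanLin_conjTranspose_eq_adjoint,
    Matrix.conjTranspose_eq_transpose_of_trivial] at h
end

section
/- (Reciprocally convex combination bound.) Let R, S₁₂ ∈ ℝ^{r×r} with R symmetric positive definite, and suppose the block matrix [[R, S₁₂], [S₁₂ᵀ, R]] ∈ ℝ^{2r×2r} is positive semidefinite. Then for every α ∈ (0, 1) and all v₁, v₂ ∈ ℝʳ: (1/α) v₁ᵀ R v₁ + (1/(1 − α)) v₂ᵀ R v₂ ≥ v₁ᵀ R v₁ + 2 v₁ᵀ S₁₂ v₂ + v₂ᵀ R v₂. -/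
open Matrix

/-- The quadratic form of a positive semidefinite block matrix, evaluated at `(x, y)`. -/
theorem Matrix.PosSemidef.fromBlocks_quadratic_nonneg {m n : Type*} [Fintype m] [Fintype n]
    {A : Matrix m m ℝ} {B : Matrix m n ℝ} {D : Matrix n n ℝ}
    (h : (Matrix.fromBlocks A B Bᵀ D).PosSemidef) (x : m → ℝ) (y : n → ℝ) :
    0 ≤ x ⬝ᵥ A *ᵥ x + 2 * (x ⬝ᵥ B *ᵥ y) + y ⬝ᵥ D *ᵥ y := by
  have hxy := h.dotProduct_mulVec_nonneg (Sum.elim x y)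
  have hcross : y ⬝ᵥ Bᵀ *ᵥ x = x ⬝ᵥ B *ᵥ y := by
    rw [mulVec_transpose, dotProduct_comm, ← dotProduct_mulVec]
  rw [star_trivial, fromBlocks_mulVec, sumElim_dotProduct_sumElim, Sum.elim_comp_inl,
    Sum.elim_comp_inr, dotProduct_add, dotProduct_add, hcross] at hxy
  linarith

/-- (Reciprocally convex combination bound.) If `R` is symmetric
positive definite and `[[R, S₁₂], [S₁₂ᵀ, R]] ⪰ 0`, then for every `α ∈ (0,1)` and all
`v₁, v₂`: `(1/α) v₁ᵀRv₁ + (1/(1−α)) v₂ᵀRv₂ ≥ v₁ᵀRv₁ + 2 v₁ᵀS₁₂v₂ + v₂ᵀRv₂`. -/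
theorem reciprocally_convex_combination_bound
    (r : ℕ) (R S12 : Matrix (Fin r) (Fin r) ℝ)
    (hR : R.PosDef)
    (hblock : (Matrix.fromBlocks R S12 S12ᵀ R).PosSemidef) :
    ∀ α : ℝ, α ∈ Set.Ioo (0 : ℝ) 1 → ∀ v₁ v₂ : Fin r → ℝ,
      v₁ ⬝ᵥ R.mulVec v₁ + 2 * (v₁ ⬝ᵥ S12.mulVec v₂) + v₂ ⬝ᵥ R.mulVec v₂
        ≤ (1 / α) * (v₁ ⬝ᵥ R.mulVec v₁) + (1 / (1 - α)) * (v₂ ⬝ᵥ R.mulVec v₂) := by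
  rintro α ⟨hα0, hα1⟩ v₁ v₂
  have hβ : 0 < 1 - α := sub_pos.mpr hα1
  have hq := hblock.fromBlocks_quadratic_nonneg ((1 - α) • v₁) (-α • v₂)
  simp only [mulVec_smul, dotProduct_smul, smul_dotProduct, smul_eq_mul] at hq
  rw [← sub_nonneg]
  refine (div_nonneg hq (mul_pos hα0 hβ).le).trans_eq ?_
  field_simp
  ring
end

section
/- Let R, S₁₂ ∈ ℝ^{r×r} with R symmetric positive definite and the block matrix [[R, S₁₂], [S₁₂ᵀ, R]] positive semidefinite. Let h > 0, let z : [t − h, t] → ℝʳ be continuously differentiable, and let τ ∈ [0, h]. Then −h ∫_{t−h}^{t} ż(s)ᵀ R ż(s) ds ≤ −(v₁ᵀ R v₁ + 2 v₁ᵀ S₁₂ v₂ + v₂ᵀ R v₂), where v₁ = z(t) − z(t − τ) and v₂ = z(t − τ) − z(t − h). -/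
open Matrix

/-- The bilinear form of a real symmetric matrix is symmetric. -/
theorem Matrix.IsSymm.dotProduct_mulVec_comm {n : Type*} [Fintype n] {R : Matrix n n ℝ}
    (hR : R.IsSymm) (u v : n → ℝ) : u ⬝ᵥ R *ᵥ v = v ⬝ᵥ R *ᵥ u := by
  rw [dotProduct_mulVec, ← mulVec_transpose, hR.eq, dotProduct_comm]

/-- A tangent-plane lower bound for the quadratic form of a positive semidefinite matrix. -/
theorem Matrix.PosSemidef.two_mul_dotProduct_sub_le {n : Type*} [Fintype n] {R : Matrix n n ℝ}
    (hR : R.PosSemidef) (c v : n → ℝ) :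
    2 * (c ⬝ᵥ R *ᵥ v) - c ⬝ᵥ R *ᵥ c ≤ v ⬝ᵥ R *ᵥ v := by
  have hsymm : R.IsSymm := by simpa using hR.isHermitian
  have h := hR.dotProduct_mulVec_nonneg (v - c)
  simp only [star_trivial, mulVec_sub, sub_dotProduct, dotProduct_sub] at h
  linarith [hsymm.dotProduct_mulVec_comm v c]

theorem ContinuousOn.dotProduct_mulVec_self {n : Type*} [Fintype n] (R : Matrix n n ℝ)
    {f : ℝ → n → ℝ} {s : Set ℝ} (hf : ContinuousOn f s) :
    ContinuousOn (fun x => f x ⬝ᵥ R *ᵥ f x) s :=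
  Continuous.comp_continuousOn
    (g := fun v : n → ℝ => v ⬝ᵥ R *ᵥ v) (by fun_prop) hf

/-- Jensen's inequality for the quadratic form of a positive semidefinite matrix, applied to the
derivative of a continuously differentiable curve. -/
theorem Matrix.PosSemidef.jensen_integral_deriv {n : Type*} [Fintype n] {R : Matrix n n ℝ}
    (hR : R.PosSemidef) {a b : ℝ} (hab : a ≤ b) {z z' : ℝ → n → ℝ}
    (hz : ∀ s ∈ Set.Icc a b, HasDerivWithinAt z (z' s) (Set.Icc a b) s)
    (hz' : ContinuousOn z' (Set.Icc a b)) :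
    (z b - z a) ⬝ᵥ R *ᵥ (z b - z a) ≤ (b - a) * ∫ s in a..b, z' s ⬝ᵥ R *ᵥ z' s := by
  rcases hab.eq_or_lt with rfl | hlt
  · simp
  set V := z b - z a with hV
  set c := (b - a)⁻¹ • V with hc
  have hpos : 0 < b - a := sub_pos.2 hlt
  let L : (n → ℝ) →L[ℝ] ℝ :=
    LinearMap.toContinuousLinearMap ((dotProductBilin ℝ ℝ c).comp R.mulVecLin)
  have hL (v : n → ℝ) : L v = c ⬝ᵥ R *ᵥ v := rfl
  have hLcont : ContinuousOn (fun s => L (z' s)) (Set.Icc a b) := L.continuous.comp_continuousOn hz'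
  have hLint : IntervalIntegrable (fun s => L (z' s)) MeasureTheory.volume a b :=
    hLcont.intervalIntegrable_of_Icc hab
  have hftc : ∫ s in a..b, L (z' s) = L V := by
    rw [intervalIntegral.integral_eq_sub_of_hasDerivAt_of_le (f := fun s => L (z s)) hab
      (L.continuous.comp_continuousOn fun s hs => (hz s hs).continuousWithinAt)
      (fun s hs => L.hasFDerivAt.comp_hasDerivAt s
        ((hz s (Set.Ioo_subset_Icc_self hs)).hasDerivAt (Icc_mem_nhds hs.1 hs.2))) hLint,
      ← map_sub]
  have hmono : ∫ s in a..b, (2 * L (z' s) - c ⬝ᵥ R *ᵥ c) ≤ ∫ s in a..b, z' s ⬝ᵥ R *ᵥ z' s :=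
    intervalIntegral.integral_mono_on hab
      ((hLint.const_mul 2).sub intervalIntegrable_const)
      ((hz'.dotProduct_mulVec_self R).intervalIntegrable_of_Icc hab)
      fun s _ => hR.two_mul_dotProduct_sub_le c (z' s)
  rw [intervalIntegral.integral_sub (hLint.const_mul 2) intervalIntegrable_const,
    intervalIntegral.integral_const_mul, hftc, intervalIntegral.integral_const, hL] at hmono
  simp only [hc, mulVec_smul, smul_dotProduct, dotProduct_smul, smul_eq_mul] at hmono
  calc V ⬝ᵥ R *ᵥ V
      = (b - a) * (2 * ((b - a)⁻¹ * (V ⬝ᵥ R *ᵥ V))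
          - (b - a) * ((b - a)⁻¹ * ((b - a)⁻¹ * (V ⬝ᵥ R *ᵥ V)))) := by
        field_simp
        ring
    _ ≤ _ := mul_le_mul_of_nonneg_left hmono hpos.le

/-- The quadratic form of a positive semidefinite symmetric block matrix on scaled vectors. -/
theorem Matrix.PosSemidef.fromBlocks_smul_sub_nonneg {n : Type*} [Fintype n]
    {R S : Matrix n n ℝ} (hblock : (fromBlocks R S Sᵀ R).PosSemidef) (x y : ℝ) (u v : n → ℝ) :
    0 ≤ x ^ 2 * (u ⬝ᵥ R *ᵥ u) - 2 * (x * y) * (u ⬝ᵥ S *ᵥ v) + y ^ 2 * (v ⬝ᵥ R *ᵥ v) := by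
  have h := hblock.dotProduct_mulVec_nonneg (Sum.elim (x • u) (-(y • v)))
  have hS : v ⬝ᵥ Sᵀ *ᵥ u = u ⬝ᵥ S *ᵥ v := by
    rw [mulVec_transpose, dotProduct_comm, dotProduct_mulVec]
  simp only [star_trivial, fromBlocks_mulVec, Sum.elim_comp_inl, Sum.elim_comp_inr,
    sumElim_dotProduct_sumElim, mulVec_neg, mulVec_smul, dotProduct_add, neg_dotProduct,
    dotProduct_neg, smul_dotProduct, dotProduct_smul, smul_eq_mul, hS] at h
  linarith

/-- Bound on the Jensen/reciprocally-convex split of the integral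
`−h ∫_{t−h}^{t} żᵀ R ż ds` in terms of `v₁ = z(t) − z(t−τ)` and
`v₂ = z(t−τ) − z(t−h)`, for `τ ∈ [0, h]`. -/
theorem delay_integral_reciprocally_convex_bound
    (r : ℕ) (R S12 : Matrix (Fin r) (Fin r) ℝ)
    (hR : R.PosDef)
    (hblock : (Matrix.fromBlocks R S12 S12ᵀ R).PosSemidef)
    (h t τ : ℝ) (hh : 0 < h) (hτ : τ ∈ Set.Icc (0 : ℝ) h)
    (z z' : ℝ → (Fin r → ℝ))
    (hz : ∀ s ∈ Set.Icc (t - h) t, HasDerivWithinAt z (z' s) (Set.Icc (t - h) t) s)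
    (hz' : ContinuousOn z' (Set.Icc (t - h) t)) :
    -h * ∫ s in (t - h)..t, z' s ⬝ᵥ R.mulVec (z' s)
      ≤ -((z t - z (t - τ)) ⬝ᵥ R.mulVec (z t - z (t - τ))
          + 2 * ((z t - z (t - τ)) ⬝ᵥ S12.mulVec (z (t - τ) - z (t - h)))
          + (z (t - τ) - z (t - h)) ⬝ᵥ R.mulVec (z (t - τ) - z (t - h))) := by
  obtain ⟨hτ0, hτh⟩ := hτ
  have hle₁ : t - τ ≤ t := by linarith
  have hle₂ : t - h ≤ t - τ := by linarith
  have hsub₁ : Set.Icc (t - τ) t ⊆ Set.Icc (t - h) t := Set.Icc_subset_Icc_left hle₂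
  have hsub₂ : Set.Icc (t - h) (t - τ) ⊆ Set.Icc (t - h) t := Set.Icc_subset_Icc_right hle₁
  have hJ₁ := hR.posSemidef.jensen_integral_deriv hle₁
    (fun s hs => (hz s (hsub₁ hs)).mono hsub₁) (hz'.mono hsub₁)
  have hJ₂ := hR.posSemidef.jensen_integral_deriv hle₂
    (fun s hs => (hz s (hsub₂ hs)).mono hsub₂) (hz'.mono hsub₂)
  have hcont := hz'.dotProduct_mulVec_self R
  rw [← intervalIntegral.integral_add_adjacent_intervals
    ((hcont.mono hsub₂).intervalIntegrable_of_Icc hle₂)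
    ((hcont.mono hsub₁).intervalIntegrable_of_Icc hle₁)]
  rcases hτ0.eq_or_lt with rfl | hτpos
  · simp only [sub_zero, sub_self, zero_dotProduct, intervalIntegral.integral_same] at hJ₂ ⊢
    linarith
  rcases hτh.eq_or_lt with rfl | hτlt
  · simp only [sub_self, sub_sub_cancel, mulVec_zero, dotProduct_zero,
      intervalIntegral.integral_same] at hJ₁ ⊢
    linarith
  have hB := hblock.fromBlocks_smul_sub_nonneg (h - τ) τ (z t - z (t - τ)) (z (t - τ) - z (t - h))
  rw [sub_sub_cancel] at hJ₁
  rw [sub_sub_sub_cancel_left] at hJ₂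
  set I₁ := ∫ s in (t - τ)..t, z' s ⬝ᵥ R *ᵥ z' s
  set I₂ := ∫ s in (t - h)..(t - τ), z' s ⬝ᵥ R *ᵥ z' s
  set p := (z t - z (t - τ)) ⬝ᵥ S12 *ᵥ (z (t - τ) - z (t - h))
  have hprod : 0 ≤ (τ * (h - τ)) * ((h - τ) * I₁ + τ * I₂ - 2 * p) := by
    linarith [mul_le_mul_of_nonneg_left hJ₁ (sq_nonneg (h - τ)),
      mul_le_mul_of_nonneg_left hJ₂ (sq_nonneg τ)]
  have hcross := nonneg_of_mul_nonneg_right hprod (mul_pos hτpos (sub_pos.2 hτlt))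
  linarith
end
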